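/- arXiv:2212.13276 — 14 statements merged into one kernel-verified Lean document; each statement's English description precedes it below -/
import Mathlib

section
/- Let m ≥ 1, let q : ℝ → ℝ, and let u, v : ℝ → ℝ be twice differentiable functions satisfying u'' + q·u = 0 and v'' + q·v = 0. Set u₁ = u, u₂ = v, and for i ∈ Fin m and k ∈ {1,2} define the vector field C_{i,k} on ℝ × (Fin m → ℝ) by C_{i,k}(x, y) = (y_i · u_k(x), fun j => y_i · y_j · u_k'(x)). Then for all indices (i,k), (j,l) and every point p ∈ ℝ × (Fin m → ℝ), the Lie bracket of C_{i,k} and C_{j,l} vanishes at p, i.e. (D C_{j,l})(p)(C_{i,k}(p)) − (D C_{i,k})(p)(C_{j,l}(p)) = 0. In other words, the 2m non-Cartan symmetry generators form an abelian Lie algebra of vector fields. -/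
/-- Directional derivative at `p` of the non-Cartan generator
`(x, y) ↦ (y i * w x, fun j => y i * y j * w' x)` along the vector `z`. -/
theorem fderiv_nonCartan_apply {ι : Type*} [Fintype ι] {w : ℝ → ℝ} (hw : Differentiable ℝ w)
    (hw' : Differentiable ℝ (deriv w)) (i : ι) (p z : ℝ × (ι → ℝ)) :
    fderiv ℝ (fun p : ℝ × (ι → ℝ) =>
        (p.2 i * w p.1, fun j => p.2 i * p.2 j * deriv w p.1)) p z =
      (z.2 i * w p.1 + p.2 i * (z.1 * deriv w p.1),
        fun j => (z.2 i * p.2 j + p.2 i * z.2 j) * deriv w p.1 +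
          p.2 i * p.2 j * (z.1 * deriv (deriv w) p.1)) := by
  have hcoord (j : ι) : HasFDerivAt (fun p : ℝ × (ι → ℝ) => p.2 j)
      ((ContinuousLinearMap.proj j).comp (ContinuousLinearMap.snd ℝ ℝ (ι → ℝ))) p :=
    ((ContinuousLinearMap.proj (R := ℝ) (φ := fun _ : ι => ℝ) j).comp
      (ContinuousLinearMap.snd ℝ ℝ (ι → ℝ))).hasFDerivAt
  have hfun {f : ℝ → ℝ} (hf : Differentiable ℝ f) :=
    (hf p.1).hasDerivAt.hasFDerivAt.comp p (hasFDerivAt_fst (𝕜 := ℝ) (p := p))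
  have hx := (hcoord i).mul (hfun hw)
  have hy := hasFDerivAt_pi.2 fun j => ((hcoord i).mul (hcoord j)).mul (hfun hw')
  have h := (hx.prodMk hy).fderiv
  simp only [Pi.mul_def, Function.comp_def] at h
  rw [h]
  ext <;> simp <;> ring


/-- The 2m non-Cartan symmetry generators `C_{i,k}` of the isotropic system
`y'' + q y = 0` pairwise commute: their Lie brackets vanish, so they form an
abelian Lie algebra of vector fields on `ℝ × (Fin m → ℝ)`. -/
theorem nonCartan_abelian (m : ℕ) (hm : 1 ≤ m) (q u v : ℝ → ℝ)
    (hu : Differentiable ℝ u) (hu' : Differentiable ℝ (deriv u))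
    (hv : Differentiable ℝ v) (hv' : Differentiable ℝ (deriv v))
    (hueq : ∀ x, deriv (deriv u) x + q x * u x = 0)
    (hveq : ∀ x, deriv (deriv v) x + q x * v x = 0)
    (U : Fin 2 → ℝ → ℝ) (hU0 : U 0 = u) (hU1 : U 1 = v)
    (C : Fin m → Fin 2 → (ℝ × (Fin m → ℝ)) → ℝ × (Fin m → ℝ))
    (hC : ∀ i k (x : ℝ) (y : Fin m → ℝ),
      C i k (x, y) = (y i * U k x, fun j => y i * y j * deriv (U k) x)) :
    ∀ (i j : Fin m) (k l : Fin 2) (p : ℝ × (Fin m → ℝ)),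
      fderiv ℝ (C j l) p (C i k p) - fderiv ℝ (C i k) p (C j l p) = 0 := by
  intro i j k l p
  have hCeq (i : Fin m) (k : Fin 2) : C i k = fun p : ℝ × (Fin m → ℝ) =>
      (p.2 i * U k p.1, fun j => p.2 i * p.2 j * deriv (U k) p.1) :=
    funext fun p => hC i k p.1 p.2
  have hU : ∀ k, Differentiable ℝ (U k) ∧ Differentiable ℝ (deriv (U k)) ∧
      ∀ x, deriv (deriv (U k)) x + q x * U k x = 0 :=
    Fin.forall_fin_two.2 ⟨hU0 ▸ ⟨hu, hu', hueq⟩, hU1 ▸ ⟨hv, hv', hveq⟩⟩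
  obtain ⟨hk, hk', hkeq⟩ := hU k
  obtain ⟨hl, hl', hleq⟩ := hU l
  rw [hCeq i k, hCeq j l, fderiv_nonCartan_apply hl hl', fderiv_nonCartan_apply hk hk', sub_eq_zero]
  refine Prod.ext ?_ (funext fun s => ?_)
  · ring
  · dsimp only
    linear_combination p.2 i * p.2 j * p.2 s *
      (U k p.1 * hleq p.1 - U l p.1 * hkeq p.1)
end

section
/- Let q : ℝ → ℝ, let u : ℝ → ℝ be twice differentiable with u'' + q·u = 0, let m ≥ 1, and let y : ℝ → (Fin m → ℝ) be twice differentiable with y_j'' + q·y_j = 0 for every j. Fix indices i, j ∈ Fin m and define Q : ℝ → ℝ by Q(x) = y_i(x)·y_j(x)·u'(x) − y_i(x)·u(x)·y_j'(x). Then Q is twice differentiable and Q'' + q·Q = 0. (This is exactly the statement that the characteristic of the non-Cartan vector field C_{i,k} = y_i u ∂_x + Σ_j y_i y_j u' ∂_j along any solution of the system solves the linearized equation, i.e. that C_{i,k} is a Lie point symmetry of the system y'' + q y = 0.) -/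
/-- The Wronskian of two solutions of `f'' + q f = 0` is constant. -/
theorem wronskian_eq_of_solutions {q f g : ℝ → ℝ}
    (hf : Differentiable ℝ f) (hf' : Differentiable ℝ (deriv f))
    (hfeq : ∀ x, deriv (deriv f) x + q x * f x = 0)
    (hg : Differentiable ℝ g) (hg' : Differentiable ℝ (deriv g))
    (hgeq : ∀ x, deriv (deriv g) x + q x * g x = 0) (x₁ x₂ : ℝ) :
    f x₁ * deriv g x₁ - g x₁ * deriv f x₁ = f x₂ * deriv g x₂ - g x₂ * deriv f x₂ := by
  refine is_const_of_deriv_eq_zero (f := fun x => f x * deriv g x - g x * deriv f x)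
    ((hf.mul hg').sub (hg.mul hf')) (fun x => ?_) x₁ x₂
  have h := ((hf x).hasDerivAt.mul (hg' x).hasDerivAt).sub
    ((hg x).hasDerivAt.mul (hf' x).hasDerivAt)
  refine h.deriv.trans ?_
  linear_combination f x * hgeq x - g x * hfeq x

/-- The characteristic `Q = y_i y_j u' − y_i u y_j'` of the non-Cartan vector field
`C_{i,k} = y_i u ∂_x + Σ_j y_i y_j u' ∂_j` along any solution of the isotropic
system `y_j'' + q y_j = 0` solves the linearized equation `Q'' + q Q = 0`;
i.e. `C_{i,k}` is a Lie point symmetry of the system. -/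
theorem nonCartan_characteristic_solves_linearization
    (q u : ℝ → ℝ) (hu : Differentiable ℝ u) (hu' : Differentiable ℝ (deriv u))
    (hueq : ∀ x, deriv (deriv u) x + q x * u x = 0)
    (m : ℕ) (hm : 1 ≤ m) (y : ℝ → Fin m → ℝ)
    (hy : ∀ j, Differentiable ℝ (fun x => y x j))
    (hy' : ∀ j, Differentiable ℝ (deriv (fun x => y x j)))
    (hyeq : ∀ j x, deriv (deriv (fun t => y t j)) x + q x * y x j = 0)
    (i j : Fin m) (Q : ℝ → ℝ)
    (hQ : ∀ x, Q x = y x i * y x j * deriv u x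
        - y x i * u x * deriv (fun t => y t j) x) :
    Differentiable ℝ Q ∧ Differentiable ℝ (deriv Q) ∧
      ∀ x, deriv (deriv Q) x + q x * Q x = 0 := by
  set c : ℝ := y 0 j * deriv u 0 - u 0 * deriv (fun t => y t j) 0
  have hQc : Q = fun x => y x i * c := by
    funext x
    have hW := wronskian_eq_of_solutions (hy j) (hy' j) (hyeq j) hu hu' hueq x 0
    linear_combination hQ x + y x i * hW
  have hdQ : deriv Q = fun x => deriv (fun t => y t i) x * c := by
    funext x
    rw [hQc]
    exact ((hy i x).hasDerivAt.mul_const c).deriv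
  refine ⟨?_, ?_, fun x => ?_⟩
  · rw [hQc]
    exact (hy i).mul_const c
  · rw [hdQ]
    exact (hy' i).mul_const c
  · have hddQ : deriv (deriv Q) x = deriv (deriv (fun t => y t i)) x * c := by
      rw [hdQ]
      exact ((hy' i x).hasDerivAt.mul_const c).deriv
    rw [hddQ, hQc]
    linear_combination c * hyeq i x
end

section
/- Let q : ℝ → ℝ and let u, v, y : ℝ → ℝ be twice differentiable functions each satisfying w'' + q·w = 0. Define Q(x) = u(x)·v'(x)·y(x) − u(x)·v(x)·y'(x). Then Q is twice differentiable and Q'' + q·Q = 0. (Taking v = u this verifies that F_m = −u²∂_x − u u' Σ y_i∂_i and F_p = v²∂_x + v v' Σ y_i∂_i are symmetries of y'' + q y = 0, and adding the expression with u and v interchanged verifies the symmetry F_z = 2uv∂_x + (uv' + u'v) Σ y_i∂_i.) -/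
/-- The Wronskian of two solutions of `w'' + q w = 0` has derivative zero. -/
theorem hasDerivAt_wronskian_zero {q v y : ℝ → ℝ}
    (hv : Differentiable ℝ v) (hv' : Differentiable ℝ (deriv v))
    (hy : Differentiable ℝ y) (hy' : Differentiable ℝ (deriv y))
    (hveq : ∀ x, deriv (deriv v) x + q x * v x = 0)
    (hyeq : ∀ x, deriv (deriv y) x + q x * y x = 0) (x : ℝ) :
    HasDerivAt (fun t => deriv v t * y t - v t * deriv y t) 0 x := by
  refine (((hv' x).hasDerivAt.fun_mul (hy x).hasDerivAt).fun_sub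
    ((hv x).hasDerivAt.fun_mul (hy' x).hasDerivAt)).congr_deriv ?_
  linear_combination y x * hveq x - v x * hyeq x

/-- If `u`, `v`, `y` are twice differentiable solutions of `w'' + q w = 0`, then the
characteristic `Q = u v' y − u v y'` is twice differentiable and solves `Q'' + q Q = 0`.
This verifies that the projective-type generators `F_m`, `F_p` (and `F_z`, by adding the
expression with `u` and `v` interchanged) are Lie point symmetries of `y'' + q y = 0`. -/
theorem projective_characteristic_solves_linearization
    (q u v y : ℝ → ℝ)
    (hu : Differentiable ℝ u) (hu' : Differentiable ℝ (deriv u))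
    (hv : Differentiable ℝ v) (hv' : Differentiable ℝ (deriv v))
    (hy : Differentiable ℝ y) (hy' : Differentiable ℝ (deriv y))
    (hueq : ∀ x, deriv (deriv u) x + q x * u x = 0)
    (hveq : ∀ x, deriv (deriv v) x + q x * v x = 0)
    (hyeq : ∀ x, deriv (deriv y) x + q x * y x = 0)
    (Q : ℝ → ℝ)
    (hQ : ∀ x, Q x = u x * deriv v x * y x - u x * v x * deriv y x) :
    Differentiable ℝ Q ∧ Differentiable ℝ (deriv Q) ∧
      ∀ x, deriv (deriv Q) x + q x * Q x = 0 := by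
  have hW := hasDerivAt_wronskian_zero hv hv' hy hy' hveq hyeq
  have hQW : Q = fun t => u t * (deriv v t * y t - v t * deriv y t) := by
    funext t
    rw [hQ]
    ring
  have hQ1 : ∀ x, HasDerivAt Q (deriv u x * (deriv v x * y x - v x * deriv y x)) x := by
    intro x
    rw [hQW]
    exact ((hu x).hasDerivAt.fun_mul (hW x)).congr_deriv (by ring)
  have hQ2 : ∀ x, HasDerivAt (deriv Q)
      (deriv (deriv u) x * (deriv v x * y x - v x * deriv y x)) x := by
    intro x
    rw [funext fun t => (hQ1 t).deriv]
    exact ((hu' x).hasDerivAt.fun_mul (hW x)).congr_deriv (by ring)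
  refine ⟨fun x => (hQ1 x).differentiableAt, fun x => (hQ2 x).differentiableAt, fun x => ?_⟩
  rw [(hQ2 x).deriv, hQ]
  linear_combination (deriv v x * y x - v x * deriv y x) * hueq x
end

section
/- Let q : ℝ → ℝ be differentiable and let u, v : ℝ → ℝ be twice differentiable with u'' + q·u = 0 and v'' + q·v = 0. Then each of the three functions u², u·v, v² is three times differentiable and satisfies the third-order linear ODE y''' + 4q·y' + 2q'·y = 0. -/
/-- The product of two solutions of `y'' + q y = 0` is three times differentiable and solves
`y''' + 4q y' + 2q' y = 0`. -/
theorem mul_solves_iterative_third_order {q u v : ℝ → ℝ}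
    (hq : Differentiable ℝ q)
    (hu : Differentiable ℝ u) (hu' : Differentiable ℝ (deriv u))
    (hv : Differentiable ℝ v) (hv' : Differentiable ℝ (deriv v))
    (hueq : ∀ x, deriv (deriv u) x + q x * u x = 0)
    (hveq : ∀ x, deriv (deriv v) x + q x * v x = 0) :
    Differentiable ℝ (fun x => u x * v x) ∧
      Differentiable ℝ (deriv fun x => u x * v x) ∧
      Differentiable ℝ (deriv (deriv fun x => u x * v x)) ∧
      ∀ x, deriv (deriv (deriv fun x => u x * v x)) x
          + 4 * q x * deriv (fun x => u x * v x) x + 2 * deriv q x * (u x * v x) = 0 := by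
  have hu2 (x : ℝ) : HasDerivAt (deriv u) (-(q x * u x)) x := by
    rw [← eq_neg_of_add_eq_zero_left (hueq x)]
    exact (hu' x).hasDerivAt
  have hv2 (x : ℝ) : HasDerivAt (deriv v) (-(q x * v x)) x := by
    rw [← eq_neg_of_add_eq_zero_left (hveq x)]
    exact (hv' x).hasDerivAt
  have hw1 : deriv (fun x => u x * v x) = fun x => deriv u x * v x + u x * deriv v x :=
    deriv_eq fun x => (hu x).hasDerivAt.fun_mul (hv x).hasDerivAt
  have hw2 : deriv (fun x => deriv u x * v x + u x * deriv v x) =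
      fun x => 2 * (deriv u x * deriv v x) - 2 * (q x * (u x * v x)) :=
    deriv_eq fun x => (((hu2 x).fun_mul (hv x).hasDerivAt).fun_add
      ((hu x).hasDerivAt.fun_mul (hv2 x))).congr_deriv (by ring)
  have hw3 (x : ℝ) := (((hu2 x).fun_mul (hv2 x)).const_mul 2).fun_sub
    (((hq x).hasDerivAt.fun_mul ((hu x).hasDerivAt.fun_mul (hv x).hasDerivAt)).const_mul 2)
  rw [hw1, hw2]
  refine ⟨by fun_prop, by fun_prop, by fun_prop, fun x => ?_⟩
  rw [(hw3 x).deriv]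
  ring

/-- If `u`, `v` solve the source equation `y'' + q y = 0` with `q` differentiable, then
`u²`, `u·v`, `v²` are three times differentiable and solve the third-order iterative
equation in normal form `y''' + 4q y' + 2q' y = 0`. -/
theorem iterative_third_order (q u v : ℝ → ℝ)
    (hq : Differentiable ℝ q)
    (hu : Differentiable ℝ u) (hu' : Differentiable ℝ (deriv u))
    (hv : Differentiable ℝ v) (hv' : Differentiable ℝ (deriv v))
    (hueq : ∀ x, deriv (deriv u) x + q x * u x = 0)
    (hveq : ∀ x, deriv (deriv v) x + q x * v x = 0) :
    ∀ w : ℝ → ℝ,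
      (w = fun x => u x ^ 2) ∨ (w = fun x => u x * v x) ∨ (w = fun x => v x ^ 2) →
      (Differentiable ℝ w ∧ Differentiable ℝ (deriv w) ∧
        Differentiable ℝ (deriv (deriv w)) ∧
        ∀ x, deriv (deriv (deriv w)) x + 4 * q x * deriv w x
            + 2 * deriv q x * w x = 0) := by
  rintro w (rfl | rfl | rfl)
  · simpa only [sq] using mul_solves_iterative_third_order hq hu hu' hu hu' hueq hueq
  · exact mul_solves_iterative_third_order hq hu hu' hv hv' hueq hveq
  · simpa only [sq] using mul_solves_iterative_third_order hq hv hv' hv hv' hveq hveq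
end

section
/- Let q : ℝ → ℝ be twice differentiable and let u, v : ℝ → ℝ be twice differentiable with u'' + q·u = 0 and v'' + q·v = 0. Then each of the four functions u³, u²·v, u·v², v³ is four times differentiable and satisfies the fourth-order linear ODE y'''' + 10q·y'' + 10q'·y' + (9q² + 3q'')·y = 0. -/
/-- The product of three solutions of `y'' + q y = 0` is four times differentiable and solves
`y'''' + 10q y'' + 10q' y' + (9q² + 3q'') y = 0`. -/
theorem iterative_fourth_order_mul_mul {q a b c : ℝ → ℝ}
    (hq : Differentiable ℝ q) (hq' : Differentiable ℝ (deriv q))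
    (ha : Differentiable ℝ a) (ha' : Differentiable ℝ (deriv a))
    (hb : Differentiable ℝ b) (hb' : Differentiable ℝ (deriv b))
    (hc : Differentiable ℝ c) (hc' : Differentiable ℝ (deriv c))
    (haeq : ∀ x, deriv (deriv a) x + q x * a x = 0)
    (hbeq : ∀ x, deriv (deriv b) x + q x * b x = 0)
    (hceq : ∀ x, deriv (deriv c) x + q x * c x = 0)
    {w : ℝ → ℝ} (hw : ∀ x, w x = a x * b x * c x) :
    Differentiable ℝ w ∧ Differentiable ℝ (deriv w) ∧
      Differentiable ℝ (deriv (deriv w)) ∧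
      Differentiable ℝ (deriv (deriv (deriv w))) ∧
      ∀ x, deriv (deriv (deriv (deriv w))) x + 10 * q x * deriv (deriv w) x
          + 10 * deriv q x * deriv w x
          + (9 * q x ^ 2 + 3 * deriv (deriv q) x) * w x = 0 := by
  obtain rfl : w = fun x => a x * b x * c x := funext hw
  have solution_deriv {y : ℝ → ℝ} (hy' : Differentiable ℝ (deriv y))
      (hyeq : ∀ x, deriv (deriv y) x + q x * y x = 0) (x : ℝ) :
      HasDerivAt (deriv y) (-(q x * y x)) x := by
    rw [← eq_neg_of_add_eq_zero_left (hyeq x)]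
    exact (hy' x).hasDerivAt
  have da x := (ha x).hasDerivAt
  have db x := (hb x).hasDerivAt
  have dc x := (hc x).hasDerivAt
  have dda := solution_deriv ha' haeq
  have ddb := solution_deriv hb' hbeq
  have ddc := solution_deriv hc' hceq
  have dq x := (hq x).hasDerivAt
  have ddq x := (hq' x).hasDerivAt
  set w : ℝ → ℝ := fun x => a x * b x * c x
  let w₁ : ℝ → ℝ := fun x =>
    deriv a x * b x * c x + a x * deriv b x * c x + a x * b x * deriv c x
  let s : ℝ → ℝ := fun x =>
    deriv a x * deriv b x * c x + deriv a x * b x * deriv c x + a x * deriv b x * deriv c x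
  let p : ℝ → ℝ := fun x => deriv a x * deriv b x * deriv c x
  let w₂ : ℝ → ℝ := fun x => -3 * (q x * w x) + 2 * s x
  let w₃ : ℝ → ℝ := fun x => -3 * (deriv q x * w x) - 7 * (q x * w₁ x) + 6 * p x
  have dw x : HasDerivAt w (w₁ x) x := by
    refine (((da x).mul (db x)).mul (dc x)).congr_deriv ?_
    simp only [w₁, Pi.mul_apply]
    ring
  have dw₁ x : HasDerivAt w₁ (w₂ x) x := by
    refine (((((dda x).mul (db x)).mul (dc x)).add (((da x).mul (ddb x)).mul (dc x))).add
      (((da x).mul (db x)).mul (ddc x))).congr_deriv ?_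
    simp only [w₂, w, s, Pi.mul_apply]
    ring
  have ds x : HasDerivAt s (-2 * (q x * w₁ x) + 3 * p x) x := by
    refine (((((dda x).mul (ddb x)).mul (dc x)).add (((dda x).mul (db x)).mul (ddc x))).add
      (((da x).mul (ddb x)).mul (ddc x))).congr_deriv ?_
    simp only [w₁, p, Pi.mul_apply]
    ring
  have dp x : HasDerivAt p (-(q x * s x)) x := by
    refine (((dda x).mul (ddb x)).mul (ddc x)).congr_deriv ?_
    simp only [s, Pi.mul_apply]
    ring
  have dw₂ x : HasDerivAt w₂ (w₃ x) x := by
    refine ((((dq x).mul (dw x)).const_mul (-3)).add ((ds x).const_mul 2)).congr_deriv ?_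
    simp only [w₃]
    ring
  have dw₃ x : HasDerivAt w₃ (-(10 * q x * w₂ x + 10 * deriv q x * w₁ x
      + (9 * q x ^ 2 + 3 * deriv (deriv q) x) * w x)) x := by
    refine (((((ddq x).mul (dw x)).const_mul (-3)).sub
      (((dq x).mul (dw₁ x)).const_mul 7)).add ((dp x).const_mul 6)).congr_deriv ?_
    simp only [w₂]
    ring
  have ew : deriv w = w₁ := funext fun x => (dw x).deriv
  have ew₁ : deriv w₁ = w₂ := funext fun x => (dw₁ x).deriv
  have ew₂ : deriv w₂ = w₃ := funext fun x => (dw₂ x).deriv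
  rw [ew, ew₁, ew₂]
  refine ⟨fun x => (dw x).differentiableAt, fun x => (dw₁ x).differentiableAt,
    fun x => (dw₂ x).differentiableAt, fun x => (dw₃ x).differentiableAt, fun x => ?_⟩
  rw [(dw₃ x).deriv]
  ring

/-- If `u`, `v` solve the source equation `y'' + q y = 0` with `q` twice differentiable,
then `u³`, `u²v`, `uv²`, `v³` are four times differentiable and solve the fourth-order
iterative equation in normal form `y'''' + 10q y'' + 10q' y' + (9q² + 3q'') y = 0`. -/
theorem iterative_fourth_order (q u v : ℝ → ℝ)
    (hq : Differentiable ℝ q) (hq' : Differentiable ℝ (deriv q))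
    (hu : Differentiable ℝ u) (hu' : Differentiable ℝ (deriv u))
    (hv : Differentiable ℝ v) (hv' : Differentiable ℝ (deriv v))
    (hueq : ∀ x, deriv (deriv u) x + q x * u x = 0)
    (hveq : ∀ x, deriv (deriv v) x + q x * v x = 0) :
    ∀ w : ℝ → ℝ,
      (w = fun x => u x ^ 3) ∨ (w = fun x => u x ^ 2 * v x) ∨
        (w = fun x => u x * v x ^ 2) ∨ (w = fun x => v x ^ 3) →
      (Differentiable ℝ w ∧ Differentiable ℝ (deriv w) ∧
        Differentiable ℝ (deriv (deriv w)) ∧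
        Differentiable ℝ (deriv (deriv (deriv w))) ∧
        ∀ x, deriv (deriv (deriv (deriv w))) x + 10 * q x * deriv (deriv w) x
            + 10 * deriv q x * deriv w x
            + (9 * q x ^ 2 + 3 * deriv (deriv q) x) * w x = 0) := by
  rintro w (rfl | rfl | rfl | rfl)
  · exact iterative_fourth_order_mul_mul hq hq' hu hu' hu hu' hu hu' hueq hueq hueq
      fun x => by ring
  · exact iterative_fourth_order_mul_mul hq hq' hu hu' hu hu' hv hv' hueq hueq hveq
      fun x => by ring
  · exact iterative_fourth_order_mul_mul hq hq' hu hu' hv hv' hv hv' hueq hveq hveq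
      fun x => by ring
  · exact iterative_fourth_order_mul_mul hq hq' hv hv' hv hv' hv hv' hveq hveq hveq
      fun x => by ring
end

section
/- Let q : ℝ → ℝ, let u, v : ℝ → ℝ be twice differentiable with u'' + q·u = 0, v'' + q·v = 0, and suppose the Wronskian satisfies u(x)·v'(x) − u'(x)·v(x) = 1 for all x in an interval I on which u is nowhere zero. Let w : ℝ → ℝ be twice differentiable and define y(x) = u(x) · w(v(x)/u(x)). Then for every x ∈ I, y''(x) + q(x)·y(x) = w''(v(x)/u(x)) / u(x)³. In particular y solves y'' + q y = 0 on I if and only if w'' vanishes at every point v(x)/u(x), x ∈ I. -/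
/-- If the Wronskian of `u` and `v` equals `1` at `x`, the quotient `v / u` has derivative
`1 / u ^ 2` there. -/
theorem hasDerivAt_div_of_wronskian_eq_one {u v : ℝ → ℝ} {x : ℝ}
    (hu : DifferentiableAt ℝ u x) (hv : DifferentiableAt ℝ v x) (hux : u x ≠ 0)
    (hWr : u x * deriv v x - deriv u x * v x = 1) :
    HasDerivAt (fun t => v t / u t) (1 / u x ^ 2) x := by
  refine (hv.hasDerivAt.fun_div hu.hasDerivAt hux).congr_deriv ?_
  rw [← hWr]
  ring

/-- The first derivative of the point transformation `u · w (v / u)`. -/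
theorem hasDerivAt_mul_comp_div {u v w : ℝ → ℝ} {x : ℝ}
    (hu : DifferentiableAt ℝ u x) (hv : DifferentiableAt ℝ v x) (hux : u x ≠ 0)
    (hWr : u x * deriv v x - deriv u x * v x = 1) (hw : DifferentiableAt ℝ w (v x / u x)) :
    HasDerivAt (fun t => u t * w (v t / u t))
      (deriv u x * w (v x / u x) + deriv w (v x / u x) / u x) x := by
  have hz := hasDerivAt_div_of_wronskian_eq_one hu hv hux hWr
  refine (hu.hasDerivAt.fun_mul (hw.hasDerivAt.comp x hz)).congr_deriv ?_
  simp only [Function.comp_apply]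
  field_simp

/-- The derivative of the expression for the first derivative of `u · w (v / u)`; the terms
in `w'` cancel. -/
theorem hasDerivAt_deriv_mul_comp_div {u v w : ℝ → ℝ} {x : ℝ}
    (hu : DifferentiableAt ℝ u x) (hu' : DifferentiableAt ℝ (deriv u) x)
    (hv : DifferentiableAt ℝ v x) (hux : u x ≠ 0)
    (hWr : u x * deriv v x - deriv u x * v x = 1) (hw : DifferentiableAt ℝ w (v x / u x))
    (hw' : DifferentiableAt ℝ (deriv w) (v x / u x)) :
    HasDerivAt (fun t => deriv u t * w (v t / u t) + deriv w (v t / u t) / u t)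
      (deriv (deriv u) x * w (v x / u x) + deriv (deriv w) (v x / u x) / u x ^ 3) x := by
  have hz := hasDerivAt_div_of_wronskian_eq_one hu hv hux hWr
  refine ((hu'.hasDerivAt.fun_mul (hw.hasDerivAt.comp x hz)).fun_add
    ((hw'.hasDerivAt.comp x hz).fun_div hu.hasDerivAt hux)).congr_deriv ?_
  simp only [Function.comp_apply]
  field_simp
  ring


/-- The point transformation `y = u · w(v/u)` (with `u`, `v` solutions of the source
equation `y'' + q y = 0` whose Wronskian is normalized to 1) reduces the source equation
to the trivial equation `w'' = 0`: on an open interval where `u` never vanishes one has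
`y'' + q y = w''(v/u)/u³`, so `y` solves the source equation there iff `w''` vanishes
at every point `v(x)/u(x)`. -/
theorem reduction_to_trivial (q u v : ℝ → ℝ)
    (hu : Differentiable ℝ u) (hu' : Differentiable ℝ (deriv u))
    (hv : Differentiable ℝ v) (hv' : Differentiable ℝ (deriv v))
    (hueq : ∀ x, deriv (deriv u) x + q x * u x = 0)
    (hveq : ∀ x, deriv (deriv v) x + q x * v x = 0)
    (I : Set ℝ) (hIopen : IsOpen I) (hIconn : I.OrdConnected)
    (hWr : ∀ x ∈ I, u x * deriv v x - deriv u x * v x = 1)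
    (hu0 : ∀ x ∈ I, u x ≠ 0)
    (w : ℝ → ℝ) (hw : Differentiable ℝ w) (hw' : Differentiable ℝ (deriv w))
    (y : ℝ → ℝ) (hy : ∀ x, y x = u x * w (v x / u x)) :
    (∀ x ∈ I, deriv (deriv y) x + q x * y x
        = deriv (deriv w) (v x / u x) / (u x) ^ 3) ∧
    ((∀ x ∈ I, deriv (deriv y) x + q x * y x = 0) ↔
      (∀ x ∈ I, deriv (deriv w) (v x / u x) = 0)) := by
  obtain rfl : y = fun x => u x * w (v x / u x) := funext hy
  have key : ∀ x ∈ I, deriv (deriv fun x => u x * w (v x / u x)) x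
      + q x * (u x * w (v x / u x)) = deriv (deriv w) (v x / u x) / (u x) ^ 3 := by
    intro x hx
    have hy' : deriv (fun x => u x * w (v x / u x)) =ᶠ[nhds x]
        fun t => deriv u t * w (v t / u t) + deriv w (v t / u t) / u t := by
      filter_upwards [hIopen.mem_nhds hx] with t ht
      exact (hasDerivAt_mul_comp_div (hu t) (hv t) (hu0 t ht) (hWr t ht) (hw _)).deriv
    rw [hy'.deriv_eq, (hasDerivAt_deriv_mul_comp_div (hu x) (hu' x) (hv x) (hu0 x hx)
      (hWr x hx) (hw _) (hw' _)).deriv]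
    linear_combination w (v x / u x) * hueq x
  refine ⟨key, forall₂_congr fun x hx => ?_⟩
  rw [key x hx, div_eq_zero_iff, or_iff_left (pow_ne_zero 3 (hu0 x hx))]
end

section
/- Let m ≥ 1 and let ξ : ℝ × (Fin m → ℝ) → ℝ. Let f : ℝ → ℝ be a bijective differentiable function with f'(z) ≠ 0 for every z, let Q : ℝ → Matrix (Fin m) (Fin m) ℝ be such that Q(z) is invertible for every z, and let s : ℝ → (Fin m → ℝ). Define ξ̄ : ℝ × (Fin m → ℝ) → ℝ by ξ̄(z, w) = ξ(f(z), Q(z).mulVec w + s(z)) / f'(z). Then (∃ x y₁ y₂, ξ(x, y₁) ≠ ξ(x, y₂)) ↔ (∃ z w₁ w₂, ξ̄(z, w₁) ≠ ξ̄(z, w₂)). That is, the ∂_x-component of a vector field depends explicitly on the dependent variables in the original coordinates if and only if it does so after any equivalence transformation x = f(z), y = Q(z)w + s(z); the non-Cartan property of a symmetry of a linear system of ODEs is coordinate-free. -/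
/-- The non-Cartan property of a symmetry of a linear system of ODEs is coordinate-free:
under the equivalence transformation `x = f(z)`, `y = Q(z)w + s(z)`, the `∂_x`-component
`ξ` of a vector field depends explicitly on the dependent variables iff its transform
`ξ̄(z,w) = ξ(f(z), Q(z)w + s(z))/f'(z)` does. -/
theorem nonCartan_coordinate_free (m : ℕ) (hm : 1 ≤ m)
    (ξ : ℝ × (Fin m → ℝ) → ℝ)
    (f : ℝ → ℝ) (hfbij : Function.Bijective f)
    (hfd : Differentiable ℝ f) (hf' : ∀ z, deriv f z ≠ 0)
    (Q : ℝ → Matrix (Fin m) (Fin m) ℝ) (hQ : ∀ z, IsUnit (Q z))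
    (s : ℝ → Fin m → ℝ)
    (ξbar : ℝ × (Fin m → ℝ) → ℝ)
    (hξbar : ∀ (z : ℝ) (w : Fin m → ℝ),
      ξbar (z, w) = ξ (f z, (Q z).mulVec w + s z) / deriv f z) :
    (∃ x y₁ y₂, ξ (x, y₁) ≠ ξ (x, y₂)) ↔
      (∃ z w₁ w₂, ξbar (z, w₁) ≠ ξbar (z, w₂)) := by
  have hsurj : ∀ z y, ∃ w, (Q z).mulVec w + s z = y := fun z y => by
    obtain ⟨w, hw⟩ := Matrix.mulVec_surjective_iff_isUnit.2 (hQ z) (y - s z)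
    exact ⟨w, by rw [hw, sub_add_cancel]⟩
  constructor
  · rintro ⟨x, y₁, y₂, h⟩
    obtain ⟨z, rfl⟩ := hfbij.surjective x
    obtain ⟨w₁, rfl⟩ := hsurj z y₁
    obtain ⟨w₂, rfl⟩ := hsurj z y₂
    refine ⟨z, w₁, w₂, ?_⟩
    rwa [hξbar, hξbar, Ne, div_left_inj' (hf' z)]
  · rintro ⟨z, w₁, w₂, h⟩
    rw [hξbar, hξbar, Ne, div_left_inj' (hf' z)] at h
    exact ⟨_, _, _, h⟩
end

section
/- Let ξ, φ : ℝ × ℝ → ℝ be smooth functions satisfying the determining equations of y'' = 0: ∂²ξ/∂y² = 0, ∂²φ/∂y² = 2∂²ξ/∂x∂y, 2∂²φ/∂x∂y = ∂²ξ/∂x², ∂²φ/∂x² = 0 everywhere. Then there exist unique constants a, b ∈ ℝ such that ξ(x,y) − ξ(x,0) = (a + b·x)·y for all (x,y); equivalently, every Lie point symmetry of y'' = 0 decomposes uniquely as the sum of a fiber-preserving symmetry (one whose ∂_x-component is independent of y) and a linear combination a·C₁ + b·C₂ of the two non-Cartan generators C₁ = y∂_x and C₂ = xy∂_x + y²∂_y.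 In particular, the scalar free-fall equation y'' = 0 has precisely two independent non-Cartan symmetries. -/
/-- Partial derivative with respect to the first (independent) variable. -/
noncomputable def pdx (f : ℝ × ℝ → ℝ) (p : ℝ × ℝ) : ℝ :=
  deriv (fun x => f (x, p.2)) p.1

/-- Partial derivative with respect to the second (dependent) variable. -/
noncomputable def pdy (f : ℝ × ℝ → ℝ) (p : ℝ × ℝ) : ℝ :=
  deriv (fun y => f (p.1, y)) p.2

open scoped ContDiff

theorem hasDerivAt_pdx {f : ℝ × ℝ → ℝ} {p : ℝ × ℝ} (hf : DifferentiableAt ℝ f p) :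
    HasDerivAt (fun x => f (x, p.2)) (fderiv ℝ f p (1, 0)) p.1 :=
  HasFDerivAt.comp_hasDerivAt (f := fun x : ℝ => (x, p.2)) p.1 hf.hasFDerivAt
    ((hasDerivAt_id p.1).prodMk (hasDerivAt_const p.1 p.2))

theorem hasDerivAt_pdy {f : ℝ × ℝ → ℝ} {p : ℝ × ℝ} (hf : DifferentiableAt ℝ f p) :
    HasDerivAt (fun y => f (p.1, y)) (fderiv ℝ f p (0, 1)) p.2 :=
  HasFDerivAt.comp_hasDerivAt (f := fun y : ℝ => (p.1, y)) p.2 hf.hasFDerivAt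
    ((hasDerivAt_const p.2 p.1).prodMk (hasDerivAt_id p.2))

theorem pdx_eq_fderiv {f : ℝ × ℝ → ℝ} (hf : Differentiable ℝ f) :
    pdx f = fun p => fderiv ℝ f p (1, 0) :=
  funext fun p => (hasDerivAt_pdx (hf p)).deriv

theorem pdy_eq_fderiv {f : ℝ × ℝ → ℝ} (hf : Differentiable ℝ f) :
    pdy f = fun p => fderiv ℝ f p (0, 1) :=
  funext fun p => (hasDerivAt_pdy (hf p)).deriv

theorem ContDiff.pdx {f : ℝ × ℝ → ℝ} (hf : ContDiff ℝ ∞ f) : ContDiff ℝ ∞ (_root_.pdx f) := by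
  rw [pdx_eq_fderiv (hf.differentiable (by simp))]
  exact (hf.fderiv_right (by simp)).clm_apply contDiff_const

theorem ContDiff.pdy {f : ℝ × ℝ → ℝ} (hf : ContDiff ℝ ∞ f) : ContDiff ℝ ∞ (_root_.pdy f) := by
  rw [pdy_eq_fderiv (hf.differentiable (by simp))]
  exact (hf.fderiv_right (by simp)).clm_apply contDiff_const

/-- Partial derivatives of a smooth function commute. -/
theorem pdx_pdy_comm {f : ℝ × ℝ → ℝ} (hf : ContDiff ℝ ∞ f) : pdx (pdy f) = pdy (pdx f) := by
  have hd : Differentiable ℝ f := hf.differentiable (by simp)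
  have hdd : Differentiable ℝ (fderiv ℝ f) :=
    (hf.fderiv_right (m := ∞) (by simp)).differentiable (by simp)
  rw [pdx_eq_fderiv (hf.pdy.differentiable (by simp)),
    pdy_eq_fderiv (hf.pdx.differentiable (by simp)), pdx_eq_fderiv hd, pdy_eq_fderiv hd]
  funext p
  have hsymm : IsSymmSndFDerivAt ℝ f p :=
    hf.contDiffAt.isSymmSndFDerivAt (by simpa using WithTop.coe_le_coe.2 (le_top : (2 : ℕ∞) ≤ ⊤))
  rw [fderiv_clm_apply (hdd p) (differentiableAt_const _),
    fderiv_clm_apply (hdd p) (differentiableAt_const _)]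
  simpa using hsymm.eq (1, 0) (0, 1)

theorem pdx_const_mul (c : ℝ) (f : ℝ × ℝ → ℝ) : pdx (fun p => c * f p) = fun p => c * pdx f p :=
  funext fun _ => deriv_const_mul_field c

theorem pdy_const_mul (c : ℝ) (f : ℝ × ℝ → ℝ) : pdy (fun p => c * f p) = fun p => c * pdy f p :=
  funext fun _ => deriv_const_mul_field c

/-- A differentiable function with constant derivative is affine. -/
theorem eq_add_mul_of_deriv_eq_const {f : ℝ → ℝ} {c : ℝ} (hf : Differentiable ℝ f)
    (h : ∀ t, deriv f t = c) (t : ℝ) : f t = f 0 + c * t := by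
  have hg : ∀ s, HasDerivAt (fun s => f s - c * s) 0 s := fun s => by
    have := (hf s).hasDerivAt.fun_sub ((hasDerivAt_id' s).const_mul c)
    rwa [h s, mul_one, sub_self] at this
  have := is_const_of_deriv_eq_zero (fun s => (hg s).differentiableAt) (fun s => (hg s).deriv) t 0
  simp only [mul_zero, sub_zero] at this
  linarith

/-- The determining equations force `ξ_xxy = 0`. -/
theorem pdx_pdx_pdy_eq_zero {ξ φ : ℝ × ℝ → ℝ} (hξ : ContDiff ℝ ∞ ξ) (hφ : ContDiff ℝ ∞ φ)
    (h₁ : ∀ p, pdy (pdy φ) p = 2 * pdy (pdx ξ) p)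
    (h₂ : ∀ p, 2 * pdy (pdx φ) p = pdx (pdx ξ) p) (p : ℝ × ℝ) :
    pdx (pdx (pdy ξ)) p = 0 := by
  have e₁ : pdx (pdy (pdy φ)) p = 2 * pdx (pdy (pdx ξ)) p := by
    rw [funext h₁, pdx_const_mul]
  have e₂ : 2 * pdy (pdy (pdx φ)) p = pdy (pdx (pdx ξ)) p := by
    rw [← funext h₂, pdy_const_mul]
  rw [pdx_pdy_comm hφ.pdy, pdx_pdy_comm hφ, pdx_pdy_comm hξ.pdx] at e₁
  rw [pdx_pdy_comm hξ, pdx_pdy_comm hξ.pdx]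
  linarith

/-- Every Lie point symmetry of the free-fall equation `y'' = 0` (i.e. every pair
`ξ, φ` of smooth functions satisfying the determining equations `ξ_yy = 0`,
`φ_yy = 2ξ_xy`, `2φ_xy = ξ_xx`, `φ_xx = 0`) decomposes uniquely as a
fiber-preserving symmetry plus a linear combination `a·C₁ + b·C₂` of the two
non-Cartan generators `C₁ = y∂_x`, `C₂ = xy∂_x + y²∂_y`: there exist unique
constants `a, b` with `ξ(x,y) − ξ(x,0) = (a + b·x)·y`. In particular `y'' = 0`
has precisely two independent non-Cartan symmetries. -/
theorem freeFall_two_nonCartan (ξ φ : ℝ × ℝ → ℝ)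
    (hξ : ContDiff ℝ (⊤ : ℕ∞) ξ) (hφ : ContDiff ℝ (⊤ : ℕ∞) φ)
    (hdet : ∀ p : ℝ × ℝ, pdy (pdy ξ) p = 0 ∧ pdy (pdy φ) p = 2 * pdy (pdx ξ) p ∧
      2 * pdy (pdx φ) p = pdx (pdx ξ) p ∧ pdx (pdx φ) p = 0) :
    ∃! ab : ℝ × ℝ, ∀ x y : ℝ, ξ (x, y) - ξ (x, 0) = (ab.1 + ab.2 * x) * y := by
  have hx : ∀ {f : ℝ × ℝ → ℝ}, ContDiff ℝ ∞ f → ∀ y, Differentiable ℝ fun x => f (x, y) :=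
    fun hf y x => (hasDerivAt_pdx (p := (x, y)) (hf.differentiable (by simp) _)).differentiableAt
  have hy : ∀ {f : ℝ × ℝ → ℝ}, ContDiff ℝ ∞ f → ∀ x, Differentiable ℝ fun y => f (x, y) :=
    fun hf x y => (hasDerivAt_pdy (p := (x, y)) (hf.differentiable (by simp) _)).differentiableAt
  have hxxy := pdx_pdx_pdy_eq_zero hξ hφ (fun p => (hdet p).2.1) (fun p => (hdet p).2.2.1)
  have hconst : ∀ x y, pdy ξ (x, y) = pdy ξ (x, 0) := fun x y => by
    simpa using eq_add_mul_of_deriv_eq_const (hy hξ.pdy x) (fun t => (hdet (x, t)).1) y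
  have hslope : ∀ x, pdx (pdy ξ) (x, 0) = pdx (pdy ξ) (0, 0) := fun x => by
    simpa using eq_add_mul_of_deriv_eq_const (hx hξ.pdy.pdx 0) (fun t => hxxy (t, 0)) x
  have haffine : ∀ x, pdy ξ (x, 0) = pdy ξ (0, 0) + pdx (pdy ξ) (0, 0) * x :=
    eq_add_mul_of_deriv_eq_const (hx hξ.pdy 0) hslope
  refine ⟨(pdy ξ (0, 0), pdx (pdy ξ) (0, 0)), fun x y => ?_, ?_⟩
  · have := eq_add_mul_of_deriv_eq_const (hy hξ x) (hconst x) y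
    simp only at this ⊢
    rw [this, haffine]
    ring
  · rintro ⟨a, b⟩ hab
    have key : ∀ x, pdy ξ (x, 0) = a + b * x := fun x => by
      have h := eq_add_mul_of_deriv_eq_const (hy hξ x) (hconst x) 1
      have h' := hab x 1
      simp only [mul_one] at h h'
      linarith
    have h0 := key 0
    have h1 := key 1
    have h1' := haffine 1
    ext <;> simp only <;> linarith
end

section
/- Let U = {(x, y, p) ∈ ℝ³ : y > 0, p > 0} and let F : U → ℝ be continuously differentiable. Then F satisfies the first-order PDE y·F_x + 3p·F − p²·F_p = 0 throughout U if and only if there exists a differentiable function G : (0,∞) × ℝ → ℝ such that F(x, y, p) = (p/y)³ · G(y, x/y − 1/p) for all (x, y, p) ∈ U. -/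
/-- Along the characteristic curve `t ↦ (y (t + s), y, 1 / t)`, the derivative of `t³ F` is
`t³` times the left-hand side of the determining equation. -/
theorem hasDerivAt_cube_mul_comp_characteristic {F : ℝ × ℝ × ℝ → ℝ} {y s t : ℝ} (ht : 0 < t)
    (hF : DifferentiableAt ℝ F (y * (t + s), y, t⁻¹)) :
    HasDerivAt (fun r : ℝ => r ^ 3 * F (y * (r + s), y, r⁻¹))
      (t ^ 3 * (y * fderiv ℝ F (y * (t + s), y, t⁻¹) (1, 0, 0)
        + 3 * t⁻¹ * F (y * (t + s), y, t⁻¹)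
        - t⁻¹ ^ 2 * fderiv ℝ F (y * (t + s), y, t⁻¹) (0, 0, 1))) t := by
  have hc : HasDerivAt (fun r : ℝ => (y * (r + s), y, r⁻¹)) (y * 1, 0, -(t ^ 2)⁻¹) t :=
    (((hasDerivAt_id t).add_const s).const_mul y).prodMk
      ((hasDerivAt_const t y).prodMk (hasDerivAt_inv ht.ne'))
  have hd := (hasDerivAt_pow 3 t).mul
    (HasFDerivAt.comp_hasDerivAt (f := fun r : ℝ => (y * (r + s), y, r⁻¹)) t
      hF.hasFDerivAt hc)
  refine hd.congr_deriv ?_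
  have hv : ((y * 1, 0, -(t ^ 2)⁻¹) : ℝ × ℝ × ℝ)
      = y • (1, 0, 0) + (-(t ^ 2)⁻¹) • (0, 0, 1) := by
    ext <;> simp
  rw [hv, map_add, map_smul, map_smul]
  simp only [smul_eq_mul, Function.comp_apply]
  field_simp
  push_cast
  ring


/-- On `U = {(x,y,p) : y > 0, p > 0}`, a continuously differentiable `F` satisfies the
determining equation `y·F_x + 3p·F − p²·F_p = 0` of the non-Cartan symmetry `C₁ = y∂_x`
iff `F(x,y,p) = (p/y)³·G(y, x/y − 1/p)` for some differentiable function
`G : (0,∞) × ℝ → ℝ`. -/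
theorem determining_equation_general_solution
    (U : Set (ℝ × ℝ × ℝ)) (hU : U = {u : ℝ × ℝ × ℝ | 0 < u.2.1 ∧ 0 < u.2.2})
    (F : ℝ × ℝ × ℝ → ℝ) (hF : ContDiffOn ℝ 1 F U) :
    (∀ u ∈ U, u.2.1 * fderiv ℝ F u (1, 0, 0) + 3 * u.2.2 * F u
        - u.2.2 ^ 2 * fderiv ℝ F u (0, 0, 1) = 0) ↔
      (∃ G : ℝ × ℝ → ℝ, DifferentiableOn ℝ G (Set.Ioi 0 ×ˢ Set.univ) ∧
        ∀ u ∈ U, F u = (u.2.2 / u.2.1) ^ 3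
          * G (u.2.1, u.1 / u.2.1 - 1 / u.2.2)) := by
  subst hU
  have hopen : IsOpen {u : ℝ × ℝ × ℝ | 0 < u.2.1 ∧ 0 < u.2.2} :=
    (isOpen_lt continuous_const (continuous_fst.comp continuous_snd)).and
      (isOpen_lt continuous_const (continuous_snd.comp continuous_snd))
  have hdiff : ∀ u : ℝ × ℝ × ℝ, 0 < u.2.1 ∧ 0 < u.2.2 → DifferentiableAt ℝ F u := fun u hu =>
    (hF.differentiableOn one_ne_zero).differentiableAt (hopen.mem_nhds hu)
  have hcurve : ∀ y p x : ℝ, 0 < y → 0 < p → y * (p⁻¹ + (x / y - 1 / p)) = x := by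
    intro y p x hy hp
    field_simp
    ring
  constructor
  · intro h
    refine ⟨fun v => v.1 ^ 3 * F (v.1 * (1 + v.2), v.1, 1), ?_, ?_⟩
    · rintro ⟨y, s⟩ ⟨hy, -⟩
      have hFc : DifferentiableAt ℝ (fun v : ℝ × ℝ => F (v.1 * (1 + v.2), v.1, 1)) (y, s) :=
        DifferentiableAt.comp (f := fun v : ℝ × ℝ => (v.1 * (1 + v.2), v.1, (1 : ℝ)))
          (y, s) (hdiff _ ⟨hy, one_pos⟩) (by fun_prop)
      exact ((differentiableAt_fst.pow 3).mul hFc).differentiableWithinAt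
    · rintro ⟨x, y, p⟩ ⟨hy, hp⟩
      dsimp only at hy hp ⊢
      set s := x / y - 1 / p with hs
      have hd : ∀ t ∈ Set.Ioi (0 : ℝ),
          HasDerivAt (fun r : ℝ => r ^ 3 * F (y * (r + s), y, r⁻¹)) 0 t := fun t ht =>
        (hasDerivAt_cube_mul_comp_characteristic ht (hdiff _ ⟨hy, inv_pos.2 ht⟩)).congr_deriv
          (mul_eq_zero_of_right _ (h (y * (t + s), y, t⁻¹) ⟨hy, inv_pos.2 ht⟩))
      have hconst := isOpen_Ioi.is_const_of_deriv_eq_zero isPreconnected_Ioi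
        (fun t ht => (hd t ht).differentiableAt.differentiableWithinAt)
        (fun t ht => (hd t ht).deriv)
        (Set.mem_Ioi.2 (inv_pos.2 hp)) (Set.mem_Ioi.2 one_pos)
      simp only [hs, hcurve y p x hy hp, inv_inv, inv_one, one_pow, one_mul] at hconst
      rw [hs, ← hconst]
      field_simp
  · rintro ⟨G, -, hG⟩ ⟨x, y, p⟩ ⟨hy, hp⟩
    dsimp only at hy hp ⊢
    have hd := hasDerivAt_cube_mul_comp_characteristic (F := F) (y := y)
      (s := x / y - 1 / p) (inv_pos.2 hp) (hdiff _ ⟨hy, inv_pos.2 (inv_pos.2 hp)⟩)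
    have hconst : (fun r : ℝ => r ^ 3 * F (y * (r + (x / y - 1 / p)), y, r⁻¹))
        =ᶠ[nhds p⁻¹] fun _ => y⁻¹ ^ 3 * G (y, x / y - 1 / p) := by
      filter_upwards [lt_mem_nhds (inv_pos.2 hp)] with r hr
      rw [hG _ ⟨hy, inv_pos.2 hr⟩]
      have hs : y * (r + (x / y - 1 / p)) / y - 1 / r⁻¹ = x / y - 1 / p := by
        rw [mul_div_cancel_left₀ _ hy.ne', one_div r⁻¹, inv_inv, add_sub_cancel_left]
      dsimp only
      rw [hs]
      field_simp
    have hzero := hd.unique ((hasDerivAt_const _ _).congr_of_eventuallyEq hconst)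
    simp only [hcurve y p x hy hp, inv_inv] at hzero
    exact (mul_eq_zero.1 hzero).resolve_left (pow_ne_zero 3 (inv_ne_zero hp.ne'))
end

section
/- Let H : ℝ → ℝ be differentiable, let U = {(x, y, p) ∈ ℝ³ : y ≠ 0, p ≠ 0}, and define F : U → ℝ by F(x, y, p) = (p/y)³ · H(x − y/p). Then: (a) F satisfies both y·F_x + 3p·F − p²·F_p = 0 and y·F_y + p·F_p = 0 throughout U; and (b) for every twice differentiable solution y : I → ℝ of y'' = F(x, y, y') with y(x) ≠ 0 and y'(x) ≠ 0 on the interval I, both characteristics Q₁(x) = −y(x)·y'(x) and Q₂(x) = y(x)² − x·y(x)·y'(x) satisfy the linearized equation Q'' = F_y·Q + F_p·Q' along the solution. That is, every (generally nonlinearizable) equation of the form y'' = (y'/y)³ H(x − y/y') admits the two non-Cartan point symmetries C₁ = y∂_x and C₂ = xy∂_x + y²∂_y. -/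
/-- The function `(x, y, p) ↦ (p/y)³ H(x − y/p)` is differentiable where `y ≠ 0` and `p ≠ 0`. -/
theorem differentiableAt_of_eq_div_pow_mul_comp {H : ℝ → ℝ} (hH : Differentiable ℝ H)
    {F : ℝ × ℝ × ℝ → ℝ}
    (hF : ∀ x y p : ℝ, F (x, y, p) = (p / y) ^ 3 * H (x - y / p))
    {x y p : ℝ} (hy : y ≠ 0) (hp : p ≠ 0) : DifferentiableAt ℝ F (x, y, p) := by
  have hF' : F = fun u : ℝ × ℝ × ℝ =>
      (u.2.2 / u.2.1) ^ 3 * H (u.1 - u.2.1 / u.2.2) := by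
    funext u
    exact hF u.1 u.2.1 u.2.2
  rw [hF']
  have h1 : DifferentiableAt ℝ (fun u : ℝ × ℝ × ℝ => u.2.2 / u.2.1) (x, y, p) := by
    fun_prop (disch := assumption)
  have h2 : DifferentiableAt ℝ (fun u : ℝ × ℝ × ℝ => u.1 - u.2.1 / u.2.2) (x, y, p) := by
    fun_prop (disch := assumption)
  exact (h1.pow 3).mul ((hH _).comp (x, y, p) h2)

/-- The directional derivatives of `(x, y, p) ↦ (p/y)³ H(x − y/p)`. -/
theorem fderiv_apply_of_eq_div_pow_mul_comp {H : ℝ → ℝ} (hH : Differentiable ℝ H)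
    {F : ℝ × ℝ × ℝ → ℝ}
    (hF : ∀ x y p : ℝ, F (x, y, p) = (p / y) ^ 3 * H (x - y / p))
    {x y p : ℝ} (hy : y ≠ 0) (hp : p ≠ 0) (a b c : ℝ) :
    fderiv ℝ F (x, y, p) (a, b, c) =
      3 * (p / y) ^ 2 * ((c * y - p * b) / y ^ 2) * H (x - y / p)
        + (p / y) ^ 3 * (deriv H (x - y / p) * (a - (b * p - y * c) / p ^ 2)) := by
  have hline (z d : ℝ) : HasDerivAt (fun t : ℝ => z + t * d) d 0 := by
    simpa using ((hasDerivAt_id (0 : ℝ)).mul_const d).const_add z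
  have hcurve : HasDerivAt (fun t : ℝ => (x + t * a, y + t * b, p + t * c)) (a, b, c) 0 :=
    (hline x a).prodMk ((hline y b).prodMk (hline p c))
  have h1 : HasDerivAt (fun t : ℝ => F (x + t * a, y + t * b, p + t * c))
      (fderiv ℝ F (x, y, p) (a, b, c)) 0 := by
    refine HasFDerivAt.comp_hasDerivAt (0 : ℝ) ?_ hcurve
    simpa using (differentiableAt_of_eq_div_pow_mul_comp hH hF hy hp).hasFDerivAt
  have hq := (hline p c).fun_div (hline y b) (by simpa using hy)
  have hs := (hline x a).fun_sub ((hline y b).fun_div (hline p c) (by simpa using hp))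
  have hHs := HasDerivAt.comp (0 : ℝ) (hH _).hasDerivAt hs
  have h2 := (hq.fun_pow 3).fun_mul hHs
  simp only [hF] at h1
  rw [h1.unique h2]
  simp

/-- Every equation of the form `y'' = (y'/y)³ H(x − y/y')` (generally nonlinearizable)
admits the two non-Cartan point symmetries `C₁ = y∂_x` and `C₂ = xy∂_x + y²∂_y`:
(a) `F(x,y,p) = (p/y)³ H(x − y/p)` satisfies both `y F_x + 3p F − p² F_p = 0` and
`y F_y + p F_p = 0` on `U = {y ≠ 0, p ≠ 0}`; (b) along every solution staying in `U`,
the characteristics `Q₁ = −y·y'` and `Q₂ = y² − x·y·y'` satisfy the linearized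
equation `Q'' = F_y Q + F_p Q'`. -/
theorem nonlinearizable_with_nonCartan_symmetries
    (H : ℝ → ℝ) (hH : Differentiable ℝ H)
    (U : Set (ℝ × ℝ × ℝ)) (hU : U = {u : ℝ × ℝ × ℝ | u.2.1 ≠ 0 ∧ u.2.2 ≠ 0})
    (F : ℝ × ℝ × ℝ → ℝ)
    (hF : ∀ x y p : ℝ, F (x, y, p) = (p / y) ^ 3 * H (x - y / p)) :
    (∀ u ∈ U,
      u.2.1 * fderiv ℝ F u (1, 0, 0) + 3 * u.2.2 * F u
          - u.2.2 ^ 2 * fderiv ℝ F u (0, 0, 1) = 0 ∧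
      u.2.1 * fderiv ℝ F u (0, 1, 0) + u.2.2 * fderiv ℝ F u (0, 0, 1) = 0) ∧
    (∀ (I : Set ℝ), IsOpen I → I.OrdConnected →
      ∀ y : ℝ → ℝ, DifferentiableOn ℝ y I → DifferentiableOn ℝ (deriv y) I →
        (∀ x ∈ I, y x ≠ 0 ∧ deriv y x ≠ 0) →
        (∀ x ∈ I, deriv (deriv y) x = F (x, y x, deriv y x)) →
        ∀ Q : ℝ → ℝ,
          ((∀ x, Q x = -(y x * deriv y x)) ∨
            (∀ x, Q x = y x ^ 2 - x * y x * deriv y x)) →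
          ∀ x ∈ I,
            deriv (deriv Q) x
              = fderiv ℝ F (x, y x, deriv y x) (0, 1, 0) * Q x
                + fderiv ℝ F (x, y x, deriv y x) (0, 0, 1) * deriv Q x) := by
  have hpart : ∀ x y p : ℝ, y ≠ 0 → p ≠ 0 →
      y * fderiv ℝ F (x, y, p) (1, 0, 0) + 3 * p * F (x, y, p)
          - p ^ 2 * fderiv ℝ F (x, y, p) (0, 0, 1) = 0 ∧
      y * fderiv ℝ F (x, y, p) (0, 1, 0) + p * fderiv ℝ F (x, y, p) (0, 0, 1) = 0 := by
    intro x y p hy hp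
    simp only [fderiv_apply_of_eq_div_pow_mul_comp hH hF hy hp, hF]
    constructor <;> field_simp <;> ring
  refine ⟨?_, ?_⟩
  · subst hU
    rintro ⟨x, y, p⟩ ⟨hy, hp⟩
    exact hpart x y p hy hp
  intro I hI _ y hy hy' hne hode Q hQ x hx
  have hd : ∀ z ∈ I, HasDerivAt y (deriv y z) z := fun z hz =>
    (hy.differentiableAt (hI.mem_nhds hz)).hasDerivAt
  have hd' : ∀ z ∈ I, HasDerivAt (deriv y) (F (z, y z, deriv y z)) z := fun z hz =>
    hode z hz ▸ (hy'.differentiableAt (hI.mem_nhds hz)).hasDerivAt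
  obtain ⟨hyx, hpx⟩ := hne x hx
  obtain ⟨ha, hb⟩ := hpart x _ _ hyx hpx
  have hFx : HasDerivAt (fun z => F (z, y z, deriv y z))
      (fderiv ℝ F (x, y x, deriv y x) (1, 0, 0)
        + deriv y x * fderiv ℝ F (x, y x, deriv y x) (0, 1, 0)
        + F (x, y x, deriv y x) * fderiv ℝ F (x, y x, deriv y x) (0, 0, 1)) x := by
    have hcurve := (hasDerivAt_id x).prodMk ((hd x hx).prodMk (hd' x hx))
    have h := HasFDerivAt.comp_hasDerivAt x
      (differentiableAt_of_eq_div_pow_mul_comp hH hF (x := x) hyx hpx).hasFDerivAt hcurve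
    refine h.congr_deriv ?_
    have hv : ((1, deriv y x, F (x, y x, deriv y x)) : ℝ × ℝ × ℝ) =
        (1, 0, 0) + deriv y x • (0, 1, 0) + F (x, y x, deriv y x) • (0, 0, 1) := by
      simp
    rw [hv, map_add, map_add, map_smul, map_smul, smul_eq_mul, smul_eq_mul]
  have hev {G : ℝ → ℝ} (hG : ∀ z ∈ I, HasDerivAt Q (G z) z) : deriv Q =ᶠ[nhds x] G :=
    Filter.eventually_of_mem (hI.mem_nhds hx) fun z hz => (hG z hz).deriv
  have hw := ((hd' x hx).fun_pow 2).fun_add ((hd x hx).fun_mul hFx)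
  rcases hQ with hQ | hQ
  · have hG : ∀ z ∈ I, HasDerivAt Q
        (-(deriv y z ^ 2 + y z * F (z, y z, deriv y z))) z := by
      intro z hz
      rw [funext hQ]
      exact ((hd z hz).fun_mul (hd' z hz)).fun_neg.congr_deriv (by ring)
    rw [(hev hG).deriv_eq, (hev hG).eq_of_nhds, hw.fun_neg.deriv, hQ]
    push_cast
    linear_combination -ha
  · have hG : ∀ z ∈ I, HasDerivAt Q
        (y z * deriv y z - z * (deriv y z ^ 2 + y z * F (z, y z, deriv y z))) z := by
      intro z hz
      rw [funext hQ]
      refine (((hd z hz).fun_pow 2).fun_sub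
        (((hasDerivAt_id' z).fun_mul (hd z hz)).fun_mul (hd' z hz))).congr_deriv ?_
      push_cast
      ring
    rw [(hev hG).deriv_eq, (hev hG).eq_of_nhds,
      (((hd x hx).fun_mul (hd' x hx)).fun_sub ((hasDerivAt_id' x).fun_mul hw)).deriv, hQ]
    push_cast
    linear_combination -x * ha - y x * hb
end

section
/- Let A, B, C : ℝ → ℝ, let α, β, γ : ℝ → ℝ be twice differentiable, and let b₁, s₁ : ℝ → ℝ be differentiable. Suppose that for all x, y, w ∈ ℝ the following four identities hold: (i) −2C(x)·y·α(x) + 2w·(A(x)·α(x) + α''(x)) = 0; (ii) −2B(x)·w·β(x) − 2y·(A(x)·β(x) − β''(x)) = 0; (iii) 2s₁'(x) + y·(−A(x)α(x) − 3C(x)β(x) + α''(x)) + w·(−B(x)α(x) + 3A(x)β(x) + 3β''(x)) − γ''(x) = 0; (iv) 2b₁'(x) + y·(−3A(x)α(x) − C(x)β(x) + 3α''(x)) + w·(−3B(x)α(x) + A(x)β(x) + β''(x)) − γ''(x) = 0. If α(x) ≠ 0 for all x, or β(x) ≠ 0 for all x, then A, B and C vanish identically. In other words, if a linear system y'' = A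 y + B w, w'' = C y − A w admits a symmetry whose ∂_x-component ξ = α(x)y + β(x)w + γ(x) is non-Cartan (α or β nowhere zero), then the system is the trivial system y'' = 0, w'' = 0. -/
/-- Crux of Theorem 4.1: if the determining equations (34a), (34b), (34d), (34e) of the
reduced normal form `y'' = A y + B w`, `w'' = C y − A w` hold identically in `x, y, w`
and the `∂_x`-component `ξ = α(x)y + β(x)w + γ(x)` of the symmetry is non-Cartan
(`α` or `β` nowhere zero), then `A`, `B`, `C` vanish identically, i.e. the system is
the trivial system `y'' = 0`, `w'' = 0`. -/
theorem nonCartan_forces_trivial_system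
    (A B C α β γ b₁ s₁ : ℝ → ℝ)
    (hα : Differentiable ℝ α) (hα' : Differentiable ℝ (deriv α))
    (hβ : Differentiable ℝ β) (hβ' : Differentiable ℝ (deriv β))
    (hγ : Differentiable ℝ γ) (hγ' : Differentiable ℝ (deriv γ))
    (hb₁ : Differentiable ℝ b₁) (hs₁ : Differentiable ℝ s₁)
    (h1 : ∀ x y w : ℝ,
      -2 * C x * y * α x + 2 * w * (A x * α x + deriv (deriv α) x) = 0)
    (h2 : ∀ x y w : ℝ,
      -2 * B x * w * β x - 2 * y * (A x * β x - deriv (deriv β) x) = 0)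
    (h3 : ∀ x y w : ℝ,
      2 * deriv s₁ x
        + y * (-(A x * α x) - 3 * C x * β x + deriv (deriv α) x)
        + w * (-(B x * α x) + 3 * A x * β x + 3 * deriv (deriv β) x)
        - deriv (deriv γ) x = 0)
    (h4 : ∀ x y w : ℝ,
      2 * deriv b₁ x
        + y * (-(3 * A x * α x) - C x * β x + 3 * deriv (deriv α) x)
        + w * (-(3 * B x * α x) + A x * β x + deriv (deriv β) x)
        - deriv (deriv γ) x = 0)
    (hnc : (∀ x, α x ≠ 0) ∨ (∀ x, β x ≠ 0)) :
    ∀ x, A x = 0 ∧ B x = 0 ∧ C x = 0 := by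
  intro x
  have hCα : C x * α x = 0 := by linarith [h1 x 1 0]
  have hα₂ : deriv (deriv α) x = -(A x * α x) := by linarith [h1 x 0 1]
  have hBβ : B x * β x = 0 := by linarith [h2 x 0 1]
  have hβ₂ : deriv (deriv β) x = A x * β x := by linarith [h2 x 1 0]
  have hAα : A x * α x = 0 := by
    linarith [h3 x 0 0, h3 x 1 0, h4 x 0 0, h4 x 1 0]
  have hCβ : C x * β x = 0 := by
    linarith [h3 x 0 0, h3 x 1 0, h4 x 0 0, h4 x 1 0]
  have hAβ : A x * β x = 0 := by
    linarith [h3 x 0 0, h3 x 0 1, h4 x 0 0, h4 x 0 1]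
  have hBα : B x * α x = 0 := by
    linarith [h3 x 0 0, h3 x 0 1, h4 x 0 0, h4 x 0 1]
  rcases hnc with h | h
  · simp_all
  · simp_all
end

section
/- Let T : ℝ → ℝ and let h : ℝ → ℝ be twice differentiable with h(x) > 0 for all x. Define q = 1/h². Then for every x, −2·T(x)·q(x)² + 3·q'(x)² − 2·q(x)·q''(x) = (4·h''(x) − 2·T(x)·h(x)) / h(x)⁵. Consequently, q satisfies the nonlinear ODE −2T q² + 3q'² − 2q q'' = 0 if and only if h satisfies the linear ODE h'' = (T/2)·h. In particular the auxiliary equation (26) of the paper is linearizable, hence integrable. -/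
/-- The derivative of `1 / h ^ 2`. -/
theorem deriv_one_div_sq {h : ℝ → ℝ} {x : ℝ} (hd : DifferentiableAt ℝ h x) (hx : h x ≠ 0) :
    deriv (fun y => 1 / h y ^ 2) x = -2 * deriv h x / h x ^ 3 := by
  have key := (hasDerivAt_const x (1 : ℝ)).fun_div (hd.hasDerivAt.fun_pow 2) (pow_ne_zero 2 hx)
  rw [key.deriv]
  field_simp
  ring

/-- The second derivative of `1 / h ^ 2` for nowhere vanishing `h`. -/
theorem deriv_deriv_one_div_sq {h : ℝ → ℝ} (hd : Differentiable ℝ h) (h0 : ∀ y, h y ≠ 0)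
    {x : ℝ} (hd' : DifferentiableAt ℝ (deriv h) x) :
    deriv (deriv fun y => 1 / h y ^ 2) x =
      6 * deriv h x ^ 2 / h x ^ 4 - 2 * deriv (deriv h) x / h x ^ 3 := by
  have hderiv : (deriv fun y => 1 / h y ^ 2) = fun y => -2 * deriv h y / h y ^ 3 :=
    funext fun y => deriv_one_div_sq (hd y) (h0 y)
  have hx := h0 x
  have key := (hd'.hasDerivAt.const_mul (-2)).fun_div ((hd x).hasDerivAt.fun_pow 3)
    (pow_ne_zero 3 hx)
  rw [hderiv, key.deriv]
  field_simp
  ring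

/-- With `q = 1/h²` (`h > 0` twice differentiable), one has
`−2T q² + 3q'² − 2q q'' = (4h'' − 2T h)/h⁵`; consequently `q` satisfies the nonlinear
ODE `−2T q² + 3q'² − 2q q'' = 0` iff `h` satisfies the linear ODE `h'' = (T/2)h`.
In particular the auxiliary equation (26) of the paper is linearizable, hence
integrable. -/
theorem auxiliary_equation_linearizable
    (T h : ℝ → ℝ)
    (hh : Differentiable ℝ h) (hh' : Differentiable ℝ (deriv h))
    (hpos : ∀ x, 0 < h x)
    (q : ℝ → ℝ) (hq : ∀ x, q x = 1 / (h x) ^ 2) :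
    (∀ x, -2 * T x * q x ^ 2 + 3 * (deriv q x) ^ 2 - 2 * q x * deriv (deriv q) x
        = (4 * deriv (deriv h) x - 2 * T x * h x) / (h x) ^ 5) ∧
    ((∀ x, -2 * T x * q x ^ 2 + 3 * (deriv q x) ^ 2
        - 2 * q x * deriv (deriv q) x = 0) ↔
      (∀ x, deriv (deriv h) x = (T x / 2) * h x)) := by
  obtain rfl : q = fun x => 1 / h x ^ 2 := funext hq
  have h0 : ∀ x, h x ≠ 0 := fun x => (hpos x).ne'
  have identity : ∀ x, -2 * T x * (1 / h x ^ 2) ^ 2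
      + 3 * (deriv (fun y => 1 / h y ^ 2) x) ^ 2
      - 2 * (1 / h x ^ 2) * deriv (deriv fun y => 1 / h y ^ 2) x
        = (4 * deriv (deriv h) x - 2 * T x * h x) / h x ^ 5 := by
    intro x
    have hx := h0 x
    rw [deriv_deriv_one_div_sq hh h0 (hh' x), deriv_one_div_sq (hh x) hx]
    field_simp
    ring
  refine ⟨identity, forall_congr' fun x => ?_⟩
  rw [identity x, div_eq_zero_iff, or_iff_left (pow_ne_zero 5 (h0 x))]
  constructor <;> intro hx <;> linarith
end

section
/- Let A : ℝ → Matrix (Fin 2) (Fin 2) ℝ, let y : ℝ → (Fin 2 → ℝ) be twice differentiable with y''(x) = (A(x)).mulVec (y(x)) for all x, and let f : ℝ → ℝ be three times differentiable with f'(z) > 0 for all z. Define w(z) = f'(z)^(−1/2) · y(f(z)). Then w is twice differentiable and w''(z) = (M(z)).mulVec (w(z)) for all z, where M(z) = f'(z)² · A(f(z)) + ( (3/4)·(f''(z)/f'(z))² − (1/2)·f'''(z)/f'(z) ) · 1 (with 1 the 2×2 identity matrix). Moreover, trace M(z) = 0 for all z if and only if −2·trace(A(f(z)))·f'(z)⁴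 − 3·f''(z)² + 2·f'(z)·f'''(z) = 0 for all z. -/
theorem HasDerivAt.rpow_const_logDeriv {p : ℝ → ℝ} {p' z : ℝ} (r : ℝ)
    (hp : HasDerivAt p p' z) (hpos : 0 < p z) :
    HasDerivAt (fun t => p t ^ r) (r * (p' / p z) * p z ^ r) z := by
  convert hp.rpow_const (p := r) (Or.inl hpos.ne') using 1
  rw [Real.rpow_sub_one hpos.ne']
  ring

section Liouville

variable {E : Type*} [NormedAddCommGroup E] [NormedSpace ℝ E]
  {y : ℝ → E} {f : ℝ → ℝ} {z : ℝ}

/-- First derivative of the Liouville transform `f' ^ (-1/2) • y ∘ f`. -/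
theorem hasDerivAt_liouville {y' : E} {f₂ : ℝ} (hy : HasDerivAt y y' (f z))
    (hf : DifferentiableAt ℝ f z) (hf' : HasDerivAt (deriv f) f₂ z) (hpos : 0 < deriv f z) :
    HasDerivAt (fun t => (deriv f t ^ (-(1 / 2) : ℝ)) • y (f t))
      ((deriv f z ^ (-(1 / 2) : ℝ)) •
        (deriv f z • y' + (-(1 / 2) * (f₂ / deriv f z)) • y (f z))) z := by
  refine ((hf'.rpow_const_logDeriv (-(1 / 2)) hpos).smul
    (hy.scomp z hf.hasDerivAt)).congr_deriv ?_
  dsimp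
  module

/-- Second derivative of the Liouville transform `f' ^ (-1/2) • y ∘ f`; the terms in `y'`
cancel. -/
theorem hasDerivAt_deriv_liouville {y₂ : E} {f₃ : ℝ} (hy : DifferentiableAt ℝ y (f z))
    (hy' : HasDerivAt (deriv y) y₂ (f z)) (hf : DifferentiableAt ℝ f z)
    (hf' : DifferentiableAt ℝ (deriv f) z) (hf'' : HasDerivAt (deriv (deriv f)) f₃ z)
    (hpos : 0 < deriv f z) :
    HasDerivAt (fun t => (deriv f t ^ (-(1 / 2) : ℝ)) •
        (deriv f t • deriv y (f t) +
          (-(1 / 2) * (deriv (deriv f) t / deriv f t)) • y (f t)))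
      ((deriv f z ^ (-(1 / 2) : ℝ)) •
        ((deriv f z ^ 2) • y₂ +
          ((3 / 4) * (deriv (deriv f) z / deriv f z) ^ 2
            - (1 / 2) * (f₃ / deriv f z)) • y (f z))) z := by
  have hne := hpos.ne'
  refine ((hf'.hasDerivAt.rpow_const_logDeriv (-(1 / 2)) hpos).smul
    ((hf'.hasDerivAt.smul (hy'.scomp z hf.hasDerivAt)).add
      (((hf''.div hf'.hasDerivAt hne).const_mul (-(1 / 2))).smul
        (hy.hasDerivAt.scomp z hf.hasDerivAt)))).congr_deriv ?_
  dsimp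
  match_scalars <;> field_simp <;> ring

end Liouville


/-- The equivalence transformation `x = f(z)`, `w(z) = f'(z)^{−1/2}·y(f(z))` maps the
normal-form linear system `y'' = A(x)y` to `w'' = M(z)w` with
`M = f'² A∘f + ((3/4)(f''/f')² − (1/2)f'''/f')·1`; moreover `M` is trace-free iff `f`
satisfies the nonlinear third-order ODE `−2(trace A∘f)f'⁴ − 3f''² + 2f'f''' = 0`. -/
theorem equivalence_transformation_normal_form
    (A : ℝ → Matrix (Fin 2) (Fin 2) ℝ)
    (y : ℝ → Fin 2 → ℝ)
    (hy : Differentiable ℝ y) (hy' : Differentiable ℝ (deriv y))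
    (hsol : ∀ x, deriv (deriv y) x = (A x).mulVec (y x))
    (f : ℝ → ℝ)
    (hf : Differentiable ℝ f) (hf' : Differentiable ℝ (deriv f))
    (hf'' : Differentiable ℝ (deriv (deriv f)))
    (hfpos : ∀ z, 0 < deriv f z)
    (w : ℝ → Fin 2 → ℝ)
    (hw : ∀ z, w z = (deriv f z ^ (-(1 / 2) : ℝ)) • y (f z))
    (M : ℝ → Matrix (Fin 2) (Fin 2) ℝ)
    (hM : ∀ z, M z = (deriv f z ^ 2) • A (f z)
        + ((3 / 4) * (deriv (deriv f) z / deriv f z) ^ 2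
            - (1 / 2) * (deriv (deriv (deriv f)) z / deriv f z)) • (1 : Matrix (Fin 2) (Fin 2) ℝ)) :
    (Differentiable ℝ w ∧ Differentiable ℝ (deriv w) ∧
      ∀ z, deriv (deriv w) z = (M z).mulVec (w z)) ∧
    ((∀ z, Matrix.trace (M z) = 0) ↔
      (∀ z, -2 * Matrix.trace (A (f z)) * deriv f z ^ 4
          - 3 * (deriv (deriv f) z) ^ 2
          + 2 * deriv f z * deriv (deriv (deriv f)) z = 0)) := by
  have hw_eq : w = fun t => (deriv f t ^ (-(1 / 2) : ℝ)) • y (f t) := funext hw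
  have h₁ : ∀ z, HasDerivAt w _ z := fun z => hw_eq ▸
    hasDerivAt_liouville (hy (f z)).hasDerivAt (hf z) (hf' z).hasDerivAt (hfpos z)
  have h₂ : ∀ z, HasDerivAt (deriv w) _ z := fun z => (funext fun t => (h₁ t).deriv) ▸
    hasDerivAt_deriv_liouville (hy (f z)) (hy' (f z)).hasDerivAt (hf z) (hf' z)
      (hf'' z).hasDerivAt (hfpos z)
  refine ⟨⟨fun z => (h₁ z).differentiableAt, fun z => (h₂ z).differentiableAt, fun z => ?_⟩,
    forall_congr' fun z => ?_⟩
  · rw [(h₂ z).deriv, hsol, hM, hw, Matrix.mulVec_smul, Matrix.add_mulVec, Matrix.smul_mulVec,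
      Matrix.smul_mulVec, Matrix.one_mulVec]
  · have hne := (hfpos z).ne'
    have key : -2 * Matrix.trace (A (f z)) * deriv f z ^ 4 - 3 * (deriv (deriv f) z) ^ 2
        + 2 * deriv f z * deriv (deriv (deriv f)) z
        = -2 * deriv f z ^ 2 * Matrix.trace (M z) := by
      rw [hM, Matrix.trace_add, Matrix.trace_smul, Matrix.trace_smul, Matrix.trace_one]
      simp only [Fintype.card_fin, smul_eq_mul, Nat.cast_ofNat]
      field_simp
      ring
    rw [key]
    simp [hne]
end

section
/- Let m ≥ 1 and let u, v : ℝ → ℝ be differentiable functions that are linearly independent in the real vector space of functions ℝ → ℝ. Set u₁ = u, u₂ = v and for i ∈ Fin m, k ∈ {1,2} define the vector field C_{i,k} on ℝ × (Fin m → ℝ) by C_{i,k}(x, y) = (y_i·u_k(x), fun j => y_i·y_j·u_k'(x)). Then the 2m vector fields C_{i,k} are linearly independent in the real vector space of maps ℝ × (Fin m → ℝ) → ℝ × (Fin m → ℝ): if Σ_{i,k} c_{i,k}·C_{i,k} = 0 pointwise, then all coefficients c_{i,k} vanish. -/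
/-- If `u`, `v` are linearly independent differentiable functions, then the `2m`
non-Cartan symmetry generators `C_{i,k}(x,y) = (y_i u_k(x), fun j => y_i y_j u_k'(x))`
(with `u₁ = u`, `u₂ = v`) are linearly independent in the vector space of maps
`ℝ × (Fin m → ℝ) → ℝ × (Fin m → ℝ)`. -/
theorem nonCartan_generators_linearly_independent
    (m : ℕ) (hm : 1 ≤ m) (u v : ℝ → ℝ)
    (hu : Differentiable ℝ u) (hv : Differentiable ℝ v)
    (hindep : LinearIndependent ℝ ![u, v])
    (U : Fin 2 → ℝ → ℝ) (hU0 : U 0 = u) (hU1 : U 1 = v)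
    (C : Fin m → Fin 2 → (ℝ × (Fin m → ℝ)) → ℝ × (Fin m → ℝ))
    (hC : ∀ i k (x : ℝ) (y : Fin m → ℝ),
      C i k (x, y) = (y i * U k x, fun j => y i * y j * deriv (U k) x)) :
    ∀ c : Fin m → Fin 2 → ℝ,
      (∀ p : ℝ × (Fin m → ℝ), ∑ i : Fin m, ∑ k : Fin 2, c i k • C i k p = 0) →
      ∀ i k, c i k = 0 := by
  intro c hc i
  have hzero : c i 0 • u + c i 1 • v = 0 := by
    funext x
    have h := congrArg Prod.fst (hc (x, Pi.single i 1))
    simp only [hC, Prod.fst_sum, Prod.smul_fst, Fin.sum_univ_two, Prod.fst_add,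
      Prod.fst_zero, smul_eq_mul] at h
    rw [Finset.sum_eq_single i (fun j _ hj => by simp [Pi.single_eq_of_ne hj])
      (fun hi => absurd (Finset.mem_univ i) hi)] at h
    simpa [hU0, hU1] using h
  obtain ⟨h0, h1⟩ := LinearIndependent.pair_iff.mp hindep _ _ hzero
  intro k
  fin_cases k
  · exact h0
  · exact h1
end
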